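/- Let k be a natural number and let q be a boolean query. Suppose there exist graphs G1 and G2 with q(G1) true and q(G2) false such that, for each pair (a1,b1) ∈ adom(G1)², there exists (a2,b2) ∈ adom(G2)² with (G1,a1,b1) ≃_k (G2,a2,b2). Then q is not expressed by any expression of N(∖, di) of degree at most k. -/

import Mathlib

namespace NavGraph

/-- The nonbasic features of the navigational algebra. -/
inductive Feature : Type
  | di | conv | inter | diff | proj | coproj
  deriving DecidableEq

/-- A graph over the label set `Λ`: it assigns to each label a binary relation
on the infinite universe of nodes (here `ℕ`). -/
def Graph (Λ : Type) : Type := Λ → Set (ℕ × ℕ)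

/-- The active domain of a graph. -/
def adom {Λ : Type} (G : Graph Λ) : Set ℕ :=
  {m | ∃ n : ℕ, ∃ R : Λ, (m, n) ∈ G R ∨ (n, m) ∈ G R}

/-- A graph is finite if each of its relations is finite. -/
def Graph.Finite {Λ : Type} (G : Graph Λ) : Prop := ∀ R : Λ, Set.Finite (G R)

/-- Expressions of the navigational algebra (with all nonbasic features). -/
inductive Expr (Λ : Type) : Type
  | rel (R : Λ)
  | empty
  | id
  | comp (e₁ e₂ : Expr Λ)
  | union (e₁ e₂ : Expr Λ)
  | di
  | conv (e : Expr Λ)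
  | inter (e₁ e₂ : Expr Λ)
  | diff (e₁ e₂ : Expr Λ)
  | proj1 (e : Expr Λ)
  | proj2 (e : Expr Λ)
  | coproj1 (e : Expr Λ)
  | coproj2 (e : Expr Λ)

/-- Semantics of expressions on graphs. -/
def eval {Λ : Type} : Expr Λ → Graph Λ → Set (ℕ × ℕ)
  | .rel R, G => G R
  | .empty, _ => ∅
  | .id, G => {p | p.1 = p.2 ∧ p.1 ∈ adom G}
  | .comp e₁ e₂, G => {p | ∃ z : ℕ, (p.1, z) ∈ eval e₁ G ∧ (z, p.2) ∈ eval e₂ G}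
  | .union e₁ e₂, G => eval e₁ G ∪ eval e₂ G
  | .di, G => {p | p.1 ∈ adom G ∧ p.2 ∈ adom G ∧ p.1 ≠ p.2}
  | .conv e, G => {p | (p.2, p.1) ∈ eval e G}
  | .inter e₁ e₂, G => eval e₁ G ∩ eval e₂ G
  | .diff e₁ e₂, G => eval e₁ G \ eval e₂ G
  | .proj1 e, G => {p | p.1 = p.2 ∧ p.1 ∈ adom G ∧ ∃ n : ℕ, (p.1, n) ∈ eval e G}
  | .proj2 e, G => {p | p.1 = p.2 ∧ p.1 ∈ adom G ∧ ∃ n : ℕ, (n, p.1) ∈ eval e G}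
  | .coproj1 e, G => {p | p.1 = p.2 ∧ p.1 ∈ adom G ∧ ¬ ∃ n : ℕ, (p.1, n) ∈ eval e G}
  | .coproj2 e, G => {p | p.1 = p.2 ∧ p.1 ∈ adom G ∧ ¬ ∃ n : ℕ, (n, p.1) ∈ eval e G}

/-- `e.InFrag F` holds if `e` is an expression of the language `N(F)`, i.e. it
only uses the basic operators and nonbasic features from `F`. -/
def Expr.InFrag {Λ : Type} (F : Set Feature) : Expr Λ → Prop
  | .rel _ => True
  | .empty => True
  | .id => True
  | .comp e₁ e₂ => e₁.InFrag F ∧ e₂.InFrag F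
  | .union e₁ e₂ => e₁.InFrag F ∧ e₂.InFrag F
  | .di => Feature.di ∈ F
  | .conv e => Feature.conv ∈ F ∧ e.InFrag F
  | .inter e₁ e₂ => Feature.inter ∈ F ∧ e₁.InFrag F ∧ e₂.InFrag F
  | .diff e₁ e₂ => Feature.diff ∈ F ∧ e₁.InFrag F ∧ e₂.InFrag F
  | .proj1 e => Feature.proj ∈ F ∧ e.InFrag F
  | .proj2 e => Feature.proj ∈ F ∧ e.InFrag F
  | .coproj1 e => Feature.coproj ∈ F ∧ e.InFrag F
  | .coproj2 e => Feature.coproj ∈ F ∧ e.InFrag F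

/-- Membership in the closure `F̄` of a set of nonbasic features. -/
inductive InClosure (F : Set Feature) : Feature → Prop
  | base {x : Feature} : x ∈ F → InClosure F x
  | proj_of_coproj : InClosure F .coproj → InClosure F .proj
  | proj_of_inter_di : InClosure F .inter → InClosure F .di → InClosure F .proj
  | proj_of_inter_conv : InClosure F .inter → InClosure F .conv → InClosure F .proj
  | coproj_of_diff_proj : InClosure F .diff → InClosure F .proj → InClosure F .coproj
  | inter_of_diff : InClosure F .diff → InClosure F .inter

/-- The closure `F̄` of a set of nonbasic features. -/
def closure (F : Set Feature) : Set Feature := {x | InClosure F x}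

open Classical in
/-- The set `F̃`: replace converse by projection when converse is available but
intersection is not. -/
noncomputable def tilde (F : Set Feature) : Set Feature :=
  if Feature.conv ∈ closure F ∧ Feature.inter ∉ closure F then
    (F \ {Feature.conv}) ∪ {Feature.proj}
  else F

/-- `N(F₁) ≤path N(F₂)`: every path query expressible in `N(F₁)` is expressible
in `N(F₂)`. -/
def leqPath (Λ : Type) (F₁ F₂ : Set Feature) : Prop :=
  ∀ e₁ : Expr Λ, e₁.InFrag F₁ →
    ∃ e₂ : Expr Λ, e₂.InFrag F₂ ∧ ∀ G : Graph Λ, eval e₂ G = eval e₁ G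

/-- `N(F₁) ≤bool N(F₂)`: every boolean query expressible in `N(F₁)` is
expressible in `N(F₂)`. -/
def leqBool (Λ : Type) (F₁ F₂ : Set Feature) : Prop :=
  ∀ e₁ : Expr Λ, e₁.InFrag F₁ →
    ∃ e₂ : Expr Λ, e₂.InFrag F₂ ∧
      ∀ G : Graph Λ, ((eval e₂ G).Nonempty ↔ (eval e₁ G).Nonempty)

/-- Strong separability at the level of boolean queries. -/
def StrongSepBool (Λ : Type) (F₁ F₂ : Set Feature) : Prop :=
  ∃ (e₁ : Expr Λ) (G₁ G₂ : Graph Λ), e₁.InFrag F₁ ∧ G₁.Finite ∧ G₂.Finite ∧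
    (eval e₁ G₁).Nonempty ∧ ¬ (eval e₁ G₂).Nonempty ∧
    ∀ e₂ : Expr Λ, e₂.InFrag F₂ → ((eval e₂ G₁).Nonempty ↔ (eval e₂ G₂).Nonempty)

/-- Strong separability at the level of path queries. -/
def StrongSepPath (Λ : Type) (F₁ F₂ : Set Feature) : Prop :=
  ∃ (e₁ : Expr Λ) (G : Graph Λ), e₁.InFrag F₁ ∧ G.Finite ∧
    ∀ e₂ : Expr Λ, e₂.InFrag F₂ → eval e₂ G ≠ eval e₁ G

/-- The `n`-fold composition `R ∘ ⋯ ∘ R` (with `R⁰ = id`). -/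
def rpow {Λ : Type} (R : Λ) : ℕ → Expr Λ
  | 0 => .id
  | n + 1 => .comp (.rel R) (rpow R n)

/-- The degree of an expression: the maximum depth of nested applications of
composition, projection and coprojection. -/
def degree {Λ : Type} : Expr Λ → ℕ
  | .rel _ => 0
  | .empty => 0
  | .id => 0
  | .di => 0
  | .comp e₁ e₂ => max (degree e₁) (degree e₂) + 1
  | .union e₁ e₂ => max (degree e₁) (degree e₂)
  | .conv e => degree e
  | .inter e₁ e₂ => max (degree e₁) (degree e₂)
  | .diff e₁ e₂ => max (degree e₁) (degree e₂)
  | .proj1 e => degree e + 1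
  | .proj2 e => degree e + 1
  | .coproj1 e => degree e + 1
  | .coproj2 e => degree e + 1

end NavGraph

namespace NavGraph

/-- The atomic conditions of bisimilarity between marked graphs. -/
def bisimAtoms {Λ : Type} (G₁ : Graph Λ) (a₁ b₁ : ℕ) (G₂ : Graph Λ) (a₂ b₂ : ℕ) : Prop :=
  (a₁ = b₁ ↔ a₂ = b₂) ∧ ∀ R : Λ, ((a₁, b₁) ∈ G₁ R ↔ (a₂, b₂) ∈ G₂ R)

/-- Bisimilarity up to depth `k` of the marked graphs `(G₁,a₁,b₁)` and
`(G₂,a₂,b₂)`. -/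
def bisim {Λ : Type} : ℕ → Graph Λ → ℕ → ℕ → Graph Λ → ℕ → ℕ → Prop
  | 0, G₁, a₁, b₁, G₂, a₂, b₂ => bisimAtoms G₁ a₁ b₁ G₂ a₂ b₂
  | k + 1, G₁, a₁, b₁, G₂, a₂, b₂ =>
      bisimAtoms G₁ a₁ b₁ G₂ a₂ b₂ ∧
      (∀ c₁ ∈ adom G₁, ∃ c₂ ∈ adom G₂,
        bisim k G₁ a₁ c₁ G₂ a₂ c₂ ∧ bisim k G₁ c₁ b₁ G₂ c₂ b₂) ∧
      (∀ c₂ ∈ adom G₂, ∃ c₁ ∈ adom G₁,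
        bisim k G₁ a₁ c₁ G₂ a₂ c₂ ∧ bisim k G₁ c₁ b₁ G₂ c₂ b₂)

theorem fst_mem_adom {Λ : Type} {G : Graph Λ} {R : Λ} {m n : ℕ} (h : (m, n) ∈ G R) :
    m ∈ adom G :=
  ⟨n, R, Or.inl h⟩

theorem snd_mem_adom {Λ : Type} {G : Graph Λ} {R : Λ} {m n : ℕ} (h : (m, n) ∈ G R) :
    n ∈ adom G :=
  ⟨m, R, Or.inr h⟩

theorem mem_adom_of_mem_eval {Λ : Type} {G : Graph Λ} (e : Expr Λ) {m n : ℕ}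
    (h : (m, n) ∈ eval e G) : m ∈ adom G ∧ n ∈ adom G := by
  induction e generalizing m n with
  | rel R => exact ⟨fst_mem_adom h, snd_mem_adom h⟩
  | empty => exact h.elim
  | id =>
    obtain ⟨rfl, hm⟩ : m = n ∧ m ∈ adom G := h
    exact ⟨hm, hm⟩
  | comp e₁ e₂ ih₁ ih₂ =>
    obtain ⟨z, h₁, h₂⟩ := h
    exact ⟨(ih₁ h₁).1, (ih₂ h₂).2⟩
  | union e₁ e₂ ih₁ ih₂ => exact h.elim ih₁ ih₂
  | di => exact ⟨h.1, h.2.1⟩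
  | conv e ih => exact (ih h).symm
  | inter e₁ e₂ ih₁ ih₂ => exact ih₁ h.1
  | diff e₁ e₂ ih₁ ih₂ => exact ih₁ h.1
  | proj1 e ih | proj2 e ih | coproj1 e ih | coproj2 e ih =>
    have hmn : m = n := h.1
    have hm : m ∈ adom G := h.2.1
    exact ⟨hm, hmn ▸ hm⟩

theorem bisim.atoms {Λ : Type} {k : ℕ} {G₁ G₂ : Graph Λ} {a₁ b₁ a₂ b₂ : ℕ}
    (h : bisim k G₁ a₁ b₁ G₂ a₂ b₂) : bisimAtoms G₁ a₁ b₁ G₂ a₂ b₂ := by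
  cases k with
  | zero => exact h
  | succ k => exact h.1

theorem bisim.mem_eval_iff {Λ : Type} {G₁ G₂ : Graph Λ} (e : Expr Λ)
    (he : e.InFrag {Feature.diff, Feature.di}) {k : ℕ} (hk : degree e ≤ k) {a₁ b₁ a₂ b₂ : ℕ}
    (ha₁ : a₁ ∈ adom G₁) (hb₁ : b₁ ∈ adom G₁) (ha₂ : a₂ ∈ adom G₂) (hb₂ : b₂ ∈ adom G₂)
    (h : bisim k G₁ a₁ b₁ G₂ a₂ b₂) :
    (a₁, b₁) ∈ eval e G₁ ↔ (a₂, b₂) ∈ eval e G₂ := by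
  induction e generalizing k a₁ b₁ a₂ b₂ with
  | rel R => exact h.atoms.2 R
  | empty => exact Iff.rfl
  | id => simpa [eval, ha₁, ha₂] using h.atoms.1
  | comp e₁ e₂ ih₁ ih₂ =>
    cases k with
    | zero => simp [degree] at hk
    | succ k =>
      have hd : max (degree e₁) (degree e₂) ≤ k := Nat.le_of_succ_le_succ hk
      have hd₁ := (le_max_left _ _).trans hd
      have hd₂ := (le_max_right _ _).trans hd
      obtain ⟨-, forth, back⟩ := h
      constructor
      · rintro ⟨z, hz₁, hz₂⟩
        have hz := (mem_adom_of_mem_eval e₁ hz₁).2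
        obtain ⟨c, hc, hac, hcb⟩ := forth z hz
        exact ⟨c, (ih₁ he.1 hd₁ ha₁ hz ha₂ hc hac).1 hz₁,
          (ih₂ he.2 hd₂ hz hb₁ hc hb₂ hcb).1 hz₂⟩
      · rintro ⟨z, hz₁, hz₂⟩
        have hz := (mem_adom_of_mem_eval e₁ hz₁).2
        obtain ⟨c, hc, hac, hcb⟩ := back z hz
        exact ⟨c, (ih₁ he.1 hd₁ ha₁ hc ha₂ hz hac).2 hz₁,
          (ih₂ he.2 hd₂ hc hb₁ hz hb₂ hcb).2 hz₂⟩
  | union e₁ e₂ ih₁ ih₂ =>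
    exact or_congr (ih₁ he.1 ((le_max_left _ _).trans hk) ha₁ hb₁ ha₂ hb₂ h)
      (ih₂ he.2 ((le_max_right _ _).trans hk) ha₁ hb₁ ha₂ hb₂ h)
  | di => simpa [eval, ha₁, hb₁, ha₂, hb₂] using not_congr h.atoms.1
  | diff e₁ e₂ ih₁ ih₂ =>
    exact and_congr (ih₁ he.2.1 ((le_max_left _ _).trans hk) ha₁ hb₁ ha₂ hb₂ h)
      (not_congr (ih₂ he.2.2 ((le_max_right _ _).trans hk) ha₁ hb₁ ha₂ hb₂ h))
  | conv e | inter e₁ e₂ | proj1 e | proj2 e | coproj1 e | coproj2 e =>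
    simp [Expr.InFrag] at he

/-- If `q(G₁)` is true, `q(G₂)` is false and every pair of `G₁` is
bisimilar up to depth `k` to some pair of `G₂`, then `q` is not expressed by any
expression of `N(∖, di)` of degree at most `k`. -/
theorem bisim_nonexpressibility (Λ : Type) [Fintype Λ] [Nonempty Λ]
    (k : ℕ) (q : Graph Λ → Prop) (G₁ G₂ : Graph Λ)
    (hq₁ : q G₁) (hq₂ : ¬ q G₂)
    (hbis : ∀ a₁ ∈ adom G₁, ∀ b₁ ∈ adom G₁, ∃ a₂ ∈ adom G₂, ∃ b₂ ∈ adom G₂,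
      bisim k G₁ a₁ b₁ G₂ a₂ b₂) :
    ∀ e : Expr Λ, e.InFrag {Feature.diff, Feature.di} → degree e ≤ k →
      ¬ (∀ G : Graph Λ, (eval e G).Nonempty ↔ q G) := by
  intro e he hk hexp
  obtain ⟨⟨a₁, b₁⟩, hab⟩ := (hexp G₁).2 hq₁
  obtain ⟨ha₁, hb₁⟩ := mem_adom_of_mem_eval e hab
  obtain ⟨a₂, ha₂, b₂, hb₂, h⟩ := hbis a₁ ha₁ b₁ hb₁
  exact hq₂ ((hexp G₂).1 ⟨(a₂, b₂), (h.mem_eval_iff e he hk ha₁ hb₁ ha₂ hb₂).1 hab⟩)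

end NavGraph
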